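/- arXiv:2211.02330 — 4 statements merged into one kernel-verified Lean document; each statement's English description precedes it below -/
import Mathlib

section
/- Cross-event interference: there exists an execution of the function-reuse model containing two receive (Start Event) transitions, for events e' (first) and e (second) with e' ≠ e, and a promise p, such that a startAsync p transition occurs during the processing of e' (after the receive of e' and before the subsequent respond), no resolve p transition occurs afterwards, and p belongs to the promise set of some state occurring after the receive of e; i.e., during the processing of event e there is an unresolved promise that was started during the processing of the past event e'. -/
/-- The event component of a serverless-function state: either an event id,
    `free`, or `done`. -/
inductive EvComp (EventId : Type) : Type where
  | ev : EventId → EvComp EventId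
  | free : EvComp EventId
  | done : EvComp EventId

/-- A serverless-function state `σ = (M, E, Pr)`. -/
structure FnState (Var Val EventId Promise : Type) [DecidableEq Promise] : Type where
  M : Var → Val
  E : EvComp EventId
  Pr : Finset Promise

/-- Transition labels (`eps` is the Invalidate Env label of the function-reuse model). -/
inductive RLabel (Var Val Promise : Type) : Type where
  | receive : Val → RLabel Var Val Promise
  | respond : Val → RLabel Var Val Promise
  | exec : ((Var → Val) → (Var → Val)) → RLabel Var Val Promise
  | startAsync : Promise → RLabel Var Val Promise
  | resolve : Promise → RLabel Var Val Promise
  | eps : RLabel Var Val Promise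

/-- Small-step transitions of the function-reuse model: `respond` yields `free` and
    an extra `eps` (Invalidate Env) transition maps a `free` state to a `done` state. -/
inductive RStep {Var Val EventId Promise : Type} [DecidableEq Var] [DecidableEq Promise]
    (input response : Var) :
    FnState Var Val EventId Promise → RLabel Var Val Promise →
    FnState Var Val EventId Promise → Prop where
  | receive (M : Var → Val) (Pr : Finset Promise) (v : Val) (e : EventId) :
      RStep input response ⟨M, .free, Pr⟩ (.receive v)
        ⟨Function.update M input v, .ev e, Pr⟩
  | respond (M : Var → Val) (Pr : Finset Promise) (e : EventId) (v : Val)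
      (h : M response = v) :
      RStep input response ⟨M, .ev e, Pr⟩ (.respond v) ⟨M, .free, Pr⟩
  | invalidate (M : Var → Val) (Pr : Finset Promise) :
      RStep input response ⟨M, .free, Pr⟩ .eps ⟨M, .done, Pr⟩
  | exec (M : Var → Val) (Pr : Finset Promise) (e : EventId)
      (C : (Var → Val) → (Var → Val)) :
      RStep input response ⟨M, .ev e, Pr⟩ (.exec C) ⟨C M, .ev e, Pr⟩
  | startAsync (M : Var → Val) (E : EvComp EventId) (Pr : Finset Promise) (p : Promise)
      (h : p ∉ Pr) :
      RStep input response ⟨M, E, Pr⟩ (.startAsync p) ⟨M, E, insert p Pr⟩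
  | resolve (M : Var → Val) (E : EvComp EventId) (Pr : Finset Promise) (p : Promise)
      (h : p ∈ Pr) :
      RStep input response ⟨M, E, Pr⟩ (.resolve p) ⟨M, E, Pr.erase p⟩

/-- A finite execution of length `n` of the function-reuse model, starting from the
    initial state `(M₀, free, ∅)`. -/
def RExec {Var Val EventId Promise : Type} [DecidableEq Var] [DecidableEq Promise]
    (input response : Var) (M₀ : Var → Val) (n : ℕ)
    (states : ℕ → FnState Var Val EventId Promise)
    (labels : ℕ → RLabel Var Val Promise) : Prop :=
  states 0 = ⟨M₀, .free, (∅ : Finset Promise)⟩ ∧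
  ∀ i < n, RStep input response (states i) (labels i) (states (i + 1))

/-- Cross-event interference: there exists an execution of the function-reuse model with
two `receive` (Start Event) transitions, for events `e'` (first) and `e` (second) with
`e' ≠ e`, and a promise `p`, such that a `startAsync p` transition occurs during the
processing of `e'` (after the receive of `e'` and before the subsequent respond), no
`resolve p` transition occurs afterwards, and `p` belongs to the promise set of some
state occurring after the receive of `e`. -/
theorem cross_event_interference
    {Var Val EventId Promise : Type} [DecidableEq Var] [DecidableEq Promise]
    [Nontrivial EventId] [Nontrivial Promise]
    (input response : Var) (M₀ : Var → Val) :
    ∃ (n : ℕ) (states : ℕ → FnState Var Val EventId Promise)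
      (labels : ℕ → RLabel Var Val Promise),
      RExec input response M₀ n states labels ∧
      ∃ (i₁ k r i₂ : ℕ) (e' e : EventId) (p : Promise),
        i₁ < k ∧ k < r ∧ r < i₂ ∧ i₂ < n ∧
        (∃ v : Val, labels i₁ = .receive v) ∧ (states (i₁ + 1)).E = .ev e' ∧
        (∃ v : Val, labels i₂ = .receive v) ∧ (states (i₂ + 1)).E = .ev e ∧
        e' ≠ e ∧
        labels k = .startAsync p ∧
        (∃ v : Val, labels r = .respond v) ∧
        (∀ j, i₁ < j → j < r → ∀ v : Val, labels j ≠ .respond v) ∧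
        (∀ j, k < j → j < n → labels j ≠ .resolve p) ∧
        (∃ m, i₂ < m ∧ m ≤ n ∧ p ∈ (states m).Pr) := by
  obtain ⟨e', e, hne⟩ := exists_pair_ne EventId
  obtain ⟨p⟩ : Nonempty Promise := inferInstance
  have hreceive (Pr : Finset Promise) (a : EventId) :
      RStep input response ⟨M₀, .free, Pr⟩ (.receive (M₀ input)) ⟨M₀, .ev a, Pr⟩ := by
    simpa using RStep.receive (input := input) (response := response) M₀ Pr (M₀ input) a
  let states : ℕ → FnState Var Val EventId Promise
    | 0 => ⟨M₀, .free, ∅⟩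
    | 1 => ⟨M₀, .ev e', ∅⟩
    | 2 => ⟨M₀, .ev e', insert p ∅⟩
    | 3 => ⟨M₀, .free, insert p ∅⟩
    | _ => ⟨M₀, .ev e, insert p ∅⟩
  let labels : ℕ → RLabel Var Val Promise
    | 0 => .receive (M₀ input)
    | 1 => .startAsync p
    | 2 => .respond (M₀ response)
    | _ => .receive (M₀ input)
  refine ⟨4, states, labels, ⟨rfl, fun i hi => ?_⟩, 0, 1, 2, 3, e', e, p, by decide, by decide,
    by decide, by decide, ⟨_, rfl⟩, rfl, ⟨_, rfl⟩, rfl, hne, rfl, ⟨_, rfl⟩, ?_, ?_,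
    4, by decide, le_rfl, Finset.mem_insert_self p ∅⟩
  · interval_cases i
    · exact hreceive ∅ e'
    · exact .startAsync M₀ (.ev e') ∅ p (Finset.notMem_empty p)
    · exact .respond M₀ (insert p ∅) e' (M₀ response) rfl
    · exact hreceive (insert p ∅) e
  · intro j hj hj' v
    interval_cases j
    simp [labels]
  · intro j hj hj'
    interval_cases j <;> simp [labels]
end

section
/- No broken promises: in the proposed semantics, in any execution, if an end (End Event) transition occurs at some step, then for every promise p, every startAsync p transition occurring before that step is followed, still strictly before that step, by a resolve p transition; equivalently, every promise started during the processing of an event is either resolved before the function ends, or the function never ends. -/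
/-- Transition labels of the proposed semantics: `endEv` is the explicit `end()`
    termination and `eps` is the Invalidate Env label. -/
inductive PLabel (Var Val Promise : Type) : Type where
  | receive : Val → PLabel Var Val Promise
  | respond : Val → PLabel Var Val Promise
  | endEv : PLabel Var Val Promise
  | exec : ((Var → Val) → (Var → Val)) → PLabel Var Val Promise
  | startAsync : Promise → PLabel Var Val Promise
  | resolve : Promise → PLabel Var Val Promise
  | eps : PLabel Var Val Promise

/-- Small-step transitions of the proposed semantics: `receive` requires an empty
    promise set, `respond` leaves the state unchanged, and the explicit `endEv`
    requires an empty promise set and yields a `free` state. -/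
inductive PStep {Var Val EventId Promise : Type} [DecidableEq Var] [DecidableEq Promise]
    (input response : Var) :
    FnState Var Val EventId Promise → PLabel Var Val Promise →
    FnState Var Val EventId Promise → Prop where
  | receive (M : Var → Val) (v : Val) (e : EventId) :
      PStep input response ⟨M, .free, (∅ : Finset Promise)⟩ (.receive v)
        ⟨Function.update M input v, .ev e, (∅ : Finset Promise)⟩
  | respond (M : Var → Val) (Pr : Finset Promise) (e : EventId) (v : Val)
      (h : M response = v) :
      PStep input response ⟨M, .ev e, Pr⟩ (.respond v) ⟨M, .ev e, Pr⟩
  | endEv (M : Var → Val) (e : EventId) :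
      PStep input response ⟨M, .ev e, (∅ : Finset Promise)⟩ .endEv
        ⟨M, .free, (∅ : Finset Promise)⟩
  | invalidate (M : Var → Val) (Pr : Finset Promise) :
      PStep input response ⟨M, .free, Pr⟩ .eps ⟨M, .done, Pr⟩
  | exec (M : Var → Val) (Pr : Finset Promise) (e : EventId)
      (C : (Var → Val) → (Var → Val)) :
      PStep input response ⟨M, .ev e, Pr⟩ (.exec C) ⟨C M, .ev e, Pr⟩
  | startAsync (M : Var → Val) (E : EvComp EventId) (Pr : Finset Promise) (p : Promise)
      (h : p ∉ Pr) :
      PStep input response ⟨M, E, Pr⟩ (.startAsync p) ⟨M, E, insert p Pr⟩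
  | resolve (M : Var → Val) (E : EvComp EventId) (Pr : Finset Promise) (p : Promise)
      (h : p ∈ Pr) :
      PStep input response ⟨M, E, Pr⟩ (.resolve p) ⟨M, E, Pr.erase p⟩

/-- A finite execution of length `n` of the proposed semantics, starting from the
    initial state `(M₀, free, ∅)`. -/
def PExec {Var Val EventId Promise : Type} [DecidableEq Var] [DecidableEq Promise]
    (input response : Var) (M₀ : Var → Val) (n : ℕ)
    (states : ℕ → FnState Var Val EventId Promise)
    (labels : ℕ → PLabel Var Val Promise) : Prop :=
  states 0 = ⟨M₀, .free, (∅ : Finset Promise)⟩ ∧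
  ∀ i < n, PStep input response (states i) (labels i) (states (i + 1))

/-- A step other than `resolve p` keeps `p` in the promise set. -/
theorem PStep.mem_of_mem {Var Val EventId Promise : Type} [DecidableEq Var]
    [DecidableEq Promise] {input response : Var} {s s' : FnState Var Val EventId Promise}
    {l : PLabel Var Val Promise} (hs : PStep input response s l s') {p : Promise}
    (hp : p ∈ s.Pr) (hl : l ≠ .resolve p) : p ∈ s'.Pr := by
  cases hs with
  | startAsync M E Pr q h => exact Finset.mem_insert_of_mem hp
  | resolve M E Pr q h =>
    exact Finset.mem_erase_of_ne_of_mem (fun hpq => hl (by rw [hpq])) hp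
  | _ => exact hp

/-- After `startAsync p`, the promise `p` is pending. -/
theorem PStep.mem_of_startAsync {Var Val EventId Promise : Type} [DecidableEq Var]
    [DecidableEq Promise] {input response : Var} {s s' : FnState Var Val EventId Promise}
    {p : Promise} (hs : PStep input response s (.startAsync p) s') : p ∈ s'.Pr := by
  cases hs
  exact Finset.mem_insert_self _ _

/-- An `endEv` step is only possible when no promise is pending. -/
theorem PStep.pr_eq_empty_of_endEv {Var Val EventId Promise : Type} [DecidableEq Var]
    [DecidableEq Promise] {input response : Var} {s s' : FnState Var Val EventId Promise}
    (hs : PStep input response s .endEv s') : s.Pr = ∅ := by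
  cases hs
  rfl

/-- No broken promises: in the proposed semantics, in any execution, if an `end`
(End Event) transition occurs at some step, then for every promise `p`, every
`startAsync p` transition occurring before that step is followed, still strictly before
that step, by a `resolve p` transition; i.e. every promise started during the processing
of an event is either resolved before the function ends, or the function never ends. -/
theorem no_broken_promises
    {Var Val EventId Promise : Type} [DecidableEq Var] [DecidableEq Promise]
    (input response : Var) (M₀ : Var → Val) (n : ℕ)
    (states : ℕ → FnState Var Val EventId Promise)
    (labels : ℕ → PLabel Var Val Promise)
    (hexec : PExec input response M₀ n states labels) :
    ∀ t < n, labels t = .endEv →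
      ∀ p : Promise, ∀ i < t, labels i = .startAsync p →
        ∃ j, i < j ∧ j < t ∧ labels j = .resolve p := by
  intro t ht hend p i hi hstart
  by_contra! hnot
  have hpending : ∀ k, i + 1 ≤ k → k ≤ t → p ∈ (states k).Pr := by
    intro k hk
    induction k, hk using Nat.le_induction with
    | base =>
      intro _
      have hs := hexec.2 i (hi.trans ht)
      rw [hstart] at hs
      exact hs.mem_of_startAsync
    | succ k hk ih =>
      intro hkt
      exact (hexec.2 k (by omega)).mem_of_mem (ih (by omega)) (hnot k hk hkt)
  have hs := hexec.2 t ht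
  rw [hend] at hs
  have hp := hpending t hi le_rfl
  rw [hs.pr_eq_empty_of_endEv] at hp
  exact Finset.notMem_empty p hp
end

section
/- No cross-event interference: in the proposed semantics, in any execution, consider any state reached during the processing of an event e, i.e., after a receive transition creating event id e and before any subsequent receive transition. Then every promise p belonging to that state's promise set was added by a startAsync p transition occurring after the receive transition for e; i.e., every unresolved promise running during the processing of an event was also created during the processing of that event. -/
/-- A promise present after a step that is not a `receive` was either present before
the step or is added by it. -/
theorem PStep.mem_Pr_or_startAsync
    {Var Val EventId Promise : Type} [DecidableEq Var] [DecidableEq Promise]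
    {input response : Var} {s t : FnState Var Val EventId Promise}
    {l : PLabel Var Val Promise} (h : PStep input response s l t)
    {p : Promise} (hp : p ∈ t.Pr) : p ∈ s.Pr ∨ l = .startAsync p := by
  cases h with
  | startAsync M E Pr q h =>
    rcases Finset.mem_insert.mp hp with rfl | hp
    · exact .inr rfl
    · exact .inl hp
  | resolve M E Pr q h => exact .inl (Finset.mem_of_mem_erase hp)
  | _ => exact .inl hp

/-- The promise set is empty right after a `receive` step. -/
theorem PStep.Pr_eq_empty_of_receive
    {Var Val EventId Promise : Type} [DecidableEq Var] [DecidableEq Promise]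
    {input response : Var} {s t : FnState Var Val EventId Promise} {v : Val}
    (h : PStep input response s (.receive v) t) : t.Pr = ∅ := by
  cases h
  rfl

/-- No cross-event interference: in the proposed semantics, in any execution, consider a
state reached during the processing of an event `e`, i.e. after a `receive` transition
creating event id `e` and before any subsequent `receive` transition. Then every promise
`p` in that state's promise set was added by a `startAsync p` transition occurring after
the receive transition for `e`. -/
theorem no_cross_event_interference
    {Var Val EventId Promise : Type} [DecidableEq Var] [DecidableEq Promise]
    (input response : Var) (M₀ : Var → Val) (n : ℕ)
    (states : ℕ → FnState Var Val EventId Promise)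
    (labels : ℕ → PLabel Var Val Promise)
    (hexec : PExec input response M₀ n states labels) :
    ∀ i < n, ∀ v : Val, labels i = .receive v →
      ∀ e : EventId, (states (i + 1)).E = .ev e →
      ∀ m, i < m → m ≤ n →
        (∀ j, i < j → j < m → ∀ v' : Val, labels j ≠ .receive v') →
        ∀ p ∈ (states m).Pr,
          ∃ k, i < k ∧ k < m ∧ labels k = .startAsync p := by
  intro i hi v hv e _ m him
  induction m, him using Nat.le_induction with
  | base =>
    intro _ _ p hp
    have hstep := hexec.2 i hi
    rw [hv] at hstep
    simp [hstep.Pr_eq_empty_of_receive] at hp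
  | succ m him ih =>
    intro hmn hrec p hp
    rcases (hexec.2 m hmn).mem_Pr_or_startAsync hp with hp | hl
    · obtain ⟨k, hik, hkm, hk⟩ :=
        ih (Nat.le_of_succ_le hmn) (fun j hij hjm => hrec j hij (Nat.lt_succ_of_lt hjm)) p hp
      exact ⟨k, hik, Nat.lt_succ_of_lt hkm, hk⟩
    · exact ⟨m, him, Nat.lt_succ_self m, hl⟩
end

section
/- Freedom from residual execution under Approach 1: in the function-reuse model modified so that respond (End Event) additionally requires the promise set to be empty, in any execution every promise p started by a startAsync p transition before a given respond transition is resolved by a resolve p transition strictly before that respond transition; hence every terminating run has an empty promise set at termination and no residual execution exists. -/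
/-- Transition labels (`eps` is the Invalidate Env label). -/
inductive ALabel (Var Val Promise : Type) : Type where
  | receive : Val → ALabel Var Val Promise
  | respond : Val → ALabel Var Val Promise
  | exec : ((Var → Val) → (Var → Val)) → ALabel Var Val Promise
  | startAsync : Promise → ALabel Var Val Promise
  | resolve : Promise → ALabel Var Val Promise
  | eps : ALabel Var Val Promise

/-- Small-step transitions of the Approach-1 model: the function-reuse model in which
    `respond` (End Event) additionally requires the promise set to be empty. -/
inductive AStep {Var Val EventId Promise : Type} [DecidableEq Var] [DecidableEq Promise]
    (input response : Var) :
    FnState Var Val EventId Promise → ALabel Var Val Promise →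
    FnState Var Val EventId Promise → Prop where
  | receive (M : Var → Val) (Pr : Finset Promise) (v : Val) (e : EventId) :
      AStep input response ⟨M, .free, Pr⟩ (.receive v)
        ⟨Function.update M input v, .ev e, Pr⟩
  | respond (M : Var → Val) (e : EventId) (v : Val) (h : M response = v) :
      AStep input response ⟨M, .ev e, (∅ : Finset Promise)⟩ (.respond v)
        ⟨M, .free, (∅ : Finset Promise)⟩
  | invalidate (M : Var → Val) (Pr : Finset Promise) :
      AStep input response ⟨M, .free, Pr⟩ .eps ⟨M, .done, Pr⟩
  | exec (M : Var → Val) (Pr : Finset Promise) (e : EventId)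
      (C : (Var → Val) → (Var → Val)) :
      AStep input response ⟨M, .ev e, Pr⟩ (.exec C) ⟨C M, .ev e, Pr⟩
  | startAsync (M : Var → Val) (E : EvComp EventId) (Pr : Finset Promise) (p : Promise)
      (h : p ∉ Pr) :
      AStep input response ⟨M, E, Pr⟩ (.startAsync p) ⟨M, E, insert p Pr⟩
  | resolve (M : Var → Val) (E : EvComp EventId) (Pr : Finset Promise) (p : Promise)
      (h : p ∈ Pr) :
      AStep input response ⟨M, E, Pr⟩ (.resolve p) ⟨M, E, Pr.erase p⟩

/-- A finite execution of length `n` of the Approach-1 model, starting from the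
    initial state `(M₀, free, ∅)`. -/
def AExec {Var Val EventId Promise : Type} [DecidableEq Var] [DecidableEq Promise]
    (input response : Var) (M₀ : Var → Val) (n : ℕ)
    (states : ℕ → FnState Var Val EventId Promise)
    (labels : ℕ → ALabel Var Val Promise) : Prop :=
  states 0 = ⟨M₀, .free, (∅ : Finset Promise)⟩ ∧
  ∀ i < n, AStep input response (states i) (labels i) (states (i + 1))

/-- The promise set is empty whenever a `respond` transition fires. -/
theorem AStep.promises_eq_empty_of_respond
    {Var Val EventId Promise : Type} [DecidableEq Var] [DecidableEq Promise]
    {input response : Var} {s t : FnState Var Val EventId Promise} {v : Val}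
    (h : AStep input response s (.respond v) t) : s.Pr = ∅ := by
  cases h
  rfl

/-- The promise `p` is pending right after a `startAsync p` transition. -/
theorem AStep.mem_promises_of_startAsync
    {Var Val EventId Promise : Type} [DecidableEq Var] [DecidableEq Promise]
    {input response : Var} {s t : FnState Var Val EventId Promise} {p : Promise}
    (h : AStep input response s (.startAsync p) t) : p ∈ t.Pr := by
  cases h
  simp

/-- A pending promise stays pending across every transition other than its resolution. -/
theorem AStep.mem_promises_of_ne_resolve
    {Var Val EventId Promise : Type} [DecidableEq Var] [DecidableEq Promise]
    {input response : Var} {s t : FnState Var Val EventId Promise}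
    {l : ALabel Var Val Promise} {p : Promise}
    (h : AStep input response s l t) (hp : p ∈ s.Pr) (hl : l ≠ .resolve p) :
    p ∈ t.Pr := by
  cases h with
  | startAsync => exact Finset.mem_insert_of_mem hp
  | resolve M E Pr q hq =>
    exact Finset.mem_erase.mpr ⟨fun hpq => hl (by rw [hpq]), hp⟩
  | _ => exact hp

/-- Freedom from residual execution under Approach 1: in the function-reuse model
modified so that `respond` (End Event) additionally requires the promise set to be
empty, in any execution every promise `p` started by a `startAsync p` transition before
a given `respond` transition is resolved by a `resolve p` transition strictly before
that `respond` transition; hence every terminating run has an empty promise set at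
termination and no residual execution exists. -/
theorem no_residual_execution_approach1
    {Var Val EventId Promise : Type} [DecidableEq Var] [DecidableEq Promise]
    (input response : Var) (M₀ : Var → Val) (n : ℕ)
    (states : ℕ → FnState Var Val EventId Promise)
    (labels : ℕ → ALabel Var Val Promise)
    (hexec : AExec input response M₀ n states labels) :
    ∀ r < n, ∀ v : Val, labels r = .respond v →
      (∀ p : Promise, ∀ i < r, labels i = .startAsync p →
          ∃ j, i < j ∧ j < r ∧ labels j = .resolve p) ∧
      (states r).Pr = ∅ := by
  intro r hr v hv
  have hempty : (states r).Pr = ∅ :=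
    AStep.promises_eq_empty_of_respond (hv ▸ hexec.2 r hr)
  refine ⟨fun p i hi hstart => ?_, hempty⟩
  by_contra! hres
  have hmem : ∀ k, i + 1 ≤ k → k ≤ r → p ∈ (states k).Pr := by
    intro k hk
    induction k, hk using Nat.le_induction with
    | base =>
      intro _
      exact AStep.mem_promises_of_startAsync (hstart ▸ hexec.2 i (hi.trans hr))
    | succ k hk ih =>
      intro hkr
      exact (hexec.2 k (by omega)).mem_promises_of_ne_resolve (ih (by omega))
        (hres k (by omega) (by omega))
  have hp := hmem r hi le_rfl
  simp [hempty] at hp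
end
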